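/- arXiv:2311.01184 — 3 statements merged into one kernel-verified Lean document; each statement's English description precedes it below -/
import Mathlib

section
/- Let s be a natural number and let γ : Fin (s+1) → Bool be the most-significant-bit-first binary representation of a natural number t, i.e. t = ∑_{i=0}^{s} (if γ i then 1 else 0)·2^{s−i}. Assume t + 1 < 2^{s+1}. Define the carry tuple v : Fin (s+1) → Bool by v s = true and v i = (γ (i+1)) ∧ (v (i+1)) for i < s (computed in descending order of indices). Then the bitwise XOR tuple i ↦ (γ i) XOR (v i) is the most-significant-bit-first binary representation of t + 1, i.e. t + 1 = ∑_{i=0}^{s} (if (γ i) XOR (v i) then 1 else 0)·2^{s−i}. -/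
/-- Binary increment with the carry out of the most significant bit made explicit. -/
theorem sum_bits_add_one_eq_sum_xor_carry (s : ℕ) (γ v : Fin (s + 1) → Bool)
    (hlast : v (Fin.last s) = true)
    (hv : ∀ i : Fin s, v i.castSucc = (γ i.succ && v i.succ)) :
    (∑ i : Fin (s + 1), (if γ i then 1 else 0) * 2 ^ (s - (i : ℕ))) + 1 =
      (∑ i : Fin (s + 1), (if xor (γ i) (v i) then 1 else 0) * 2 ^ (s - (i : ℕ))) +
        if γ 0 && v 0 then 2 ^ (s + 1) else 0 := by
  induction s with
  | zero =>
    have h0 : v 0 = true := hlast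
    rw [Fin.sum_univ_one, Fin.sum_univ_one]
    cases γ 0 <;> simp [h0]
  | succ s ih =>
    have ih' := ih (fun i => γ i.succ) (fun i => v i.succ) hlast fun i => hv i.succ
    have h0 : v 0 = (γ (Fin.succ 0) && v (Fin.succ 0)) := hv 0
    rw [← h0] at ih'
    rw [Fin.sum_univ_succ, Fin.sum_univ_succ (n := s + 1)]
    simp only [Fin.val_succ, Nat.add_sub_add_right, Fin.val_zero, Nat.sub_zero]
    rw [add_assoc, ih', pow_succ 2 (s + 1)]
    cases γ 0 <;> cases v 0 <;> simp <;> ring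

/-- Correctness of the binary increment formula κ_R: if γ is the
most-significant-bit-first binary representation of t, t+1 < 2^(s+1),
and v is the carry tuple (v s = true, v i = γ(i+1) ∧ v(i+1) for i < s),
then γ XOR v is the representation of t + 1. -/
theorem increment_correct (s : ℕ) (γ v : Fin (s + 1) → Bool) (t : ℕ)
    (hγ : t = ∑ i : Fin (s + 1), (if γ i then 1 else 0) * 2 ^ (s - (i : ℕ)))
    (ht : t + 1 < 2 ^ (s + 1))
    (hvlast : v ⟨s, Nat.lt_succ_self s⟩ = true)
    (hv : ∀ i : ℕ, (hi : i < s) →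
      v ⟨i, Nat.lt_succ_of_lt hi⟩ =
        (γ ⟨i + 1, Nat.succ_lt_succ hi⟩ && v ⟨i + 1, Nat.succ_lt_succ hi⟩)) :
    t + 1 = ∑ i : Fin (s + 1), (if xor (γ i) (v i) then 1 else 0) * 2 ^ (s - (i : ℕ)) := by
  have h := sum_bits_add_one_eq_sum_xor_carry s γ v hvlast fun i => hv i i.isLt
  rw [← hγ] at h
  split_ifs at h <;> omega
end

section
/- Let α be a type and Φ : α → α → Prop. Define R : ℕ → (α → α → Prop) by R 0 = Φ and R (k+1) y z = ∃ Y : α, ∀ a b : α, ((a = y ∧ b = Y) ∨ (a = Y ∧ b = z)) → R k a b. Then for every k and all y, z : α, R k y z holds if and only if there exists a sequence c : Fin (2^k + 1) → α with c 0 = y, c (last) = z, and Φ (c i) (c (i+1)) for every i < 2^k. -/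
/-- The Meyer–Stockmeyer doubling operator iterated: R 0 = Φ,
R (k+1) y z = ∃ Y, ∀ a b, ((a = y ∧ b = Y) ∨ (a = Y ∧ b = z)) → R k a b. -/
def MSIter {α : Type*} (Φ : α → α → Prop) : ℕ → α → α → Prop
  | 0 => Φ
  | k + 1 => fun y z =>
      ∃ Y : α, ∀ a b : α, ((a = y ∧ b = Y) ∨ (a = Y ∧ b = z)) → MSIter Φ k a b

theorem exists_chain_add_iff {α : Type*} (Φ : α → α → Prop) (m n : ℕ) (y z : α) :
    (∃ c : ℕ → α, c 0 = y ∧ c (m + n) = z ∧ ∀ i < m + n, Φ (c i) (c (i + 1))) ↔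
      ∃ Y, (∃ c : ℕ → α, c 0 = y ∧ c m = Y ∧ ∀ i < m, Φ (c i) (c (i + 1))) ∧
        ∃ c : ℕ → α, c 0 = Y ∧ c n = z ∧ ∀ i < n, Φ (c i) (c (i + 1)) := by
  constructor
  · rintro ⟨c, h0, hz, h⟩
    exact ⟨c m, ⟨c, h0, rfl, fun i hi => h i (by lia)⟩,
      fun i => c (m + i), rfl, hz, fun i hi => h (m + i) (by lia)⟩
  · rintro ⟨Y, ⟨c, hc0, hcm, hc⟩, d, hd0, hdn, hd⟩
    refine ⟨fun i => if i ≤ m then c i else d (i - m), by simpa using hc0, ?_, fun i hi => ?_⟩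
    · rcases Nat.eq_zero_or_pos n with rfl | hn
      · simp [hcm, ← hdn, hd0]
      · simp [hn.ne', hdn]
    · rcases lt_trichotomy i m with him | rfl | him
      · simpa [him.le, Nat.succ_le_of_lt him] using hc i him
      · simpa [hcm, hd0] using hd 0 (by lia)
      · have h := hd (i - m) (by lia)
        rw [← Nat.sub_add_comm him.le] at h
        simpa [him.not_ge, show ¬ i + 1 ≤ m by lia] using h

theorem msIter_iff_nat_chain {α : Type*} (Φ : α → α → Prop) (k : ℕ) (y z : α) :
    MSIter Φ k y z ↔
      ∃ c : ℕ → α, c 0 = y ∧ c (2 ^ k) = z ∧ ∀ i < 2 ^ k, Φ (c i) (c (i + 1)) := by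
  induction k generalizing y z with
  | zero =>
    constructor
    · exact fun h => ⟨fun i => if i = 0 then y else z, by simpa [MSIter] using h⟩
    · rintro ⟨c, rfl, rfl, h⟩
      exact h 0 (by simp)
  | succ k ih =>
    rw [pow_succ, mul_two, exists_chain_add_iff]
    simp only [← ih, MSIter]
    refine exists_congr fun Y => ⟨fun h => ⟨h _ _ (.inl ⟨rfl, rfl⟩), h _ _ (.inr ⟨rfl, rfl⟩)⟩, ?_⟩
    rintro ⟨h₁, h₂⟩ a b (⟨rfl, rfl⟩ | ⟨rfl, rfl⟩)
    exacts [h₁, h₂]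

/-- MSIter Φ k is the 2^k-fold relational composition of Φ: it holds of (y,z)
iff there is a Φ-chain of length 2^k from y to z. -/
theorem msIter_iff_chain {α : Type*} (Φ : α → α → Prop) (k : ℕ) (y z : α) :
    MSIter Φ k y z ↔
      ∃ c : Fin (2 ^ k + 1) → α,
        c 0 = y ∧ c (Fin.last (2 ^ k)) = z ∧
        ∀ i : ℕ, (hi : i < 2 ^ k) →
          Φ (c ⟨i, Nat.lt_succ_of_lt hi⟩) (c ⟨i + 1, Nat.succ_lt_succ hi⟩) := by
  rw [msIter_iff_nat_chain]
  constructor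
  · rintro ⟨c, h0, hz, h⟩
    exact ⟨fun i => c i, h0, hz, h⟩
  · rintro ⟨c, h0, hz, h⟩
    refine ⟨fun i => c (Fin.ofNat _ i), h0, ?_, fun i hi => ?_⟩
    · rw [← hz]
      refine congrArg c (Fin.ext ?_)
      simp
    · convert h i hi using 2 <;> ext <;> exact Nat.mod_eq_of_lt (by lia)
end

section
/- Let α be a type, f : α → α a function, and Φ : α → α → Prop the graph of f, i.e. Φ a b ↔ f a = b. Define R : ℕ → (α → α → Prop) by R 0 = Φ and R (k+1) y z = ∃ Y : α, ∀ a b : α, ((a = y ∧ b = Y) ∨ (a = Y ∧ b = z)) → R k a b. Then for every k and all y, z : α, R k y z holds if and only if f^[2^k] y = z, where f^[m] denotes the m-fold iterate of f. -/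
/-- When Φ is the graph of a transition function f, MSIter Φ k y z expresses
that z is the configuration reached from y after exactly 2^k steps. -/
theorem msIter_graph_iff_iterate {α : Type*} (f : α → α) (Φ : α → α → Prop)
    (hΦ : ∀ a b : α, Φ a b ↔ f a = b) (k : ℕ) (y z : α) :
    MSIter Φ k y z ↔ f^[2 ^ k] y = z := by
  induction k generalizing y z with
  | zero => simpa [MSIter] using hΦ y z
  | succ k ih =>
    have hsplit : f^[2 ^ (k + 1)] y = f^[2 ^ k] (f^[2 ^ k] y) := by
      rw [pow_succ, mul_two, Function.iterate_add_apply]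
    simp only [MSIter, ih, hsplit]
    constructor
    · rintro ⟨Y, hY⟩
      rw [hY y Y (Or.inl ⟨rfl, rfl⟩), hY Y z (Or.inr ⟨rfl, rfl⟩)]
    · rintro rfl
      refine ⟨f^[2 ^ k] y, ?_⟩
      rintro a b (⟨rfl, rfl⟩ | ⟨rfl, rfl⟩) <;> rfl
end
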